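/- arXiv:2411.19256 — 2 statements merged into one kernel-verified Lean document; each statement's English description precedes it below -/
import Mathlib

section
/- If (x^k)_{k ∈ K} is a subsequence of the iterates of the NPG method with max line search converging to a point x̄, then x̄ is an M-stationary point of min q, i.e. 0 ∈ ∇f(x̄) + ∂g(x̄), and moreover γ_k‖x^{k+1} − x^k‖ → 0 as k → ∞ along K. -/
open Filter Topology Set Metric Pointwise RealInnerProductSpace

/-- The Fréchet (regular) subdifferential of an extended-real-valued function. -/
noncomputable def frechetSubdiff {X : Type*} [NormedAddCommGroup X] [InnerProductSpace ℝ X]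
    (q : X → EReal) (x : X) : Set X :=
  {v | 0 ≤ Filter.liminf
      (fun y => (q y - q x - ((⟪v, y - x⟫ : ℝ) : EReal)) / ((‖y - x‖ : ℝ) : EReal))
      (nhdsWithin x {x}ᶜ)}

/-- The limiting (Mordukhovich) subdifferential of an extended-real-valued function. -/
noncomputable def limitingSubdiff {X : Type*} [NormedAddCommGroup X] [InnerProductSpace ℝ X]
    (q : X → EReal) (x : X) : Set X :=
  {v | ∃ (xs : ℕ → X) (vs : ℕ → X),
      Filter.Tendsto xs Filter.atTop (nhds x) ∧
      Filter.Tendsto (fun j => q (xs j)) Filter.atTop (nhds (q x)) ∧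
      Filter.Tendsto vs Filter.atTop (nhds v) ∧
      ∀ j, vs j ∈ frechetSubdiff q (xs j)}

lemma aux_frechet {X : Type*} [NormedAddCommGroup X] [InnerProductSpace ℝ X]
    (g : X → EReal) (p w : X) (a fx γ gp : ℝ) (u : X) (hgp : g p = (gp : EReal))
    (hbot : ∀ y, g y ≠ ⊥)
    (h : ∀ y : X, ((fx + ⟪w, p - u⟫ + γ / 2 * ‖p - u‖ ^ 2 : ℝ) : EReal) + g p
        ≤ ((fx + ⟪w, y - u⟫ + γ / 2 * ‖y - u‖ ^ 2 : ℝ) : EReal) + g y) :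
    - w - γ • (p - u) ∈ frechetSubdiff g p := by
  unfold frechetSubdiff
  rw [Set.mem_ofPred_eq]
  rcases eq_or_neBot (nhdsWithin p {p}ᶜ) with h0 | h0
  · rw [h0]; simp
  have hlim : Tendsto (fun y : X => ((-(γ / 2 * ‖y - p‖) : ℝ) : EReal)) (nhdsWithin p {p}ᶜ)
      (𝓝 ((0:ℝ):EReal)) := by
    apply EReal.tendsto_coe.2
    have : Continuous (fun y : X => -(γ / 2 * ‖y - p‖)) := by fun_prop
    have h2 := this.tendsto p
    simp only [sub_self, norm_zero, mul_zero, neg_zero] at h2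
    exact h2.mono_left nhdsWithin_le_nhds
  have := hlim.liminf_eq
  rw [EReal.coe_zero] at this
  rw [← this]
  refine liminf_le_liminf ?_
  filter_upwards [self_mem_nhdsWithin] with y hy
  have hyp : 0 < ‖y - p‖ := norm_pos_iff.2 (sub_ne_zero.2 hy)
  have hy2 := h y
  rw [hgp] at hy2 ⊢
  induction hgy : g y with
  | bot => exact absurd hgy (hbot y)
  | top =>
    rw [EReal.top_sub_coe, EReal.top_sub_coe, EReal.top_div_of_pos_ne_top
      (EReal.coe_pos.2 hyp) (EReal.coe_ne_top _)]
    exact le_top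
  | coe r =>
    rw [hgy] at hy2
    norm_cast at hy2 ⊢
    rw [← EReal.coe_div, EReal.coe_le_coe_iff, le_div_iff₀ hyp]
    have e : y - u = (y - p) + (p - u) := by abel
    rw [e, norm_add_sq_real, inner_add_right] at hy2
    rw [inner_sub_left, inner_neg_left, real_inner_smul_left]
    have e2 := real_inner_comm (y - p) (p - u)
    rw [e2]
    nlinarith

lemma aux_model {X : Type*} [NormedAddCommGroup X] [InnerProductSpace ℝ X]
    (f : X → ℝ) (g : X → EReal) (G : X → X) (hf : Continuous f) (hG : Continuous G)
    (hg_affine : ∃ (b : X) (c : ℝ), ∀ y, ((⟪b, y⟫ + c : ℝ) : EReal) ≤ g y)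
    (x : ℕ → X) (qx : ℕ → ℝ) (B : ℝ) (hB : ∀ k, qx k ≤ B)
    (hgx : ∀ k, g (x k) = ((qx k - f (x k) : ℝ) : EReal))
    (W : Filter ℕ) (z : X) (hW : Tendsto x W (𝓝 z)) :
    ∃ C M : ℝ, 0 ≤ C ∧ 0 ≤ M ∧ ∀ᶠ k in W, ∀ (y : X) (γ : ℝ),
      (((f (x k) + ⟪G (x k), y - x k⟫ + γ / 2 * ‖y - x k‖ ^ 2 : ℝ) : EReal) + g y
        ≤ ((f (x k) + ⟪G (x k), x k - x k⟫ + γ / 2 * ‖x k - x k‖ ^ 2 : ℝ) : EReal) + g (x k)) →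
      γ / 2 * ‖y - x k‖ ^ 2 ≤ C + M * ‖y - x k‖ := by
  obtain ⟨b, c, hbc⟩ := hg_affine
  have h1 : Tendsto (fun k => B - f (x k) - ⟪b, x k⟫ - c) W (𝓝 (B - f z - ⟪b, z⟫ - c)) := by
    have : Continuous (fun u => B - f u - ⟪b, u⟫ - c) := by fun_prop
    exact (this.tendsto z).comp hW
  have h2 : Tendsto (fun k => ‖G (x k)‖) W (𝓝 ‖G z‖) :=
    (hG.norm.tendsto z).comp hW
  refine ⟨|B - f z - ⟪b, z⟫ - c| + 1, ‖G z‖ + 1 + ‖b‖, by positivity, by positivity, ?_⟩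
  filter_upwards [h1.eventually_le_const (u := |B - f z - ⟪b, z⟫ - c| + 1)
      (by linarith [le_abs_self (B - f z - ⟪b, z⟫ - c)]),
    h2.eventually_le_const (lt_add_one _)] with k hk1 hk2 y γ hy
  have hy2 : ((f (x k) + ⟪G (x k), y - x k⟫ + γ / 2 * ‖y - x k‖ ^ 2 : ℝ) : EReal)
      + ((⟪b, y⟫ + c : ℝ) : EReal) ≤ _ := (add_le_add_right (hbc y) _).trans hy
  rw [hgx k] at hy2
  norm_cast at hy2
  simp only [sub_self, inner_zero_right, norm_zero] at hy2
  have e : ⟪b, y⟫ = ⟪b, y - x k⟫ + ⟪b, x k⟫ := by rw [inner_sub_right]; ring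
  have i1 := abs_le.1 (abs_real_inner_le_norm b (y - x k))
  have i2 := abs_le.1 (abs_real_inner_le_norm (G (x k)) (y - x k))
  have i3 := mul_le_mul_of_nonneg_right hk2 (norm_nonneg (y - x k))
  have := hB k
  nlinarith

lemma aux_descent {X : Type*} [NormedAddCommGroup X] [InnerProductSpace ℝ X] [CompleteSpace X]
    (f : X → ℝ) (hf : Differentiable ℝ f) (s : Set X) (hs : Convex ℝ s) (L : NNReal)
    (hL : LipschitzOnWith L (fun y => gradient f y) s) (u v : X) (hu : u ∈ s) (hv : v ∈ s) :
    f v ≤ f u + ⟪gradient f u, v - u⟫ + L * ‖v - u‖ ^ 2 := by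
  have h := (convex_segment u v (𝕜 := ℝ)).norm_image_sub_le_of_norm_hasFDerivWithin_le'
    (f := f) (f' := fun y => fderiv ℝ f y) (φ := fderiv ℝ f u) (C := L * ‖v - u‖)
    (fun y _ => (hf y).hasFDerivAt.hasFDerivWithinAt) (by
      intro y hy
      have hys := hs.segment_subset hu hv hy
      have h1 := hL.dist_le_mul y hys u hu
      have h2 : ‖y - u‖ ≤ ‖v - u‖ := by
        rw [segment_eq_image'] at hy
        obtain ⟨t, ⟨ht0, ht1⟩, rfl⟩ := hy
        simp only [add_sub_cancel_left, norm_smul, Real.norm_eq_abs, abs_of_nonneg ht0]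
        nlinarith [norm_nonneg (v - u)]
      rw [dist_eq_norm, dist_eq_norm] at h1
      have e : ‖fderiv ℝ f y - fderiv ℝ f u‖ = ‖gradient f y - gradient f u‖ := by
        unfold gradient
        rw [← map_sub, LinearIsometryEquiv.norm_map]
      rw [e]
      exact h1.trans (mul_le_mul_of_nonneg_left h2 L.2))
    (left_mem_segment ℝ u v) (right_mem_segment ℝ u v)
  have e : (fderiv ℝ f u) (v - u) = ⟪gradient f u, v - u⟫ := by
    unfold gradient; simp
  rw [e, Real.norm_eq_abs] at h
  nlinarith [le_abs_self (f v - f u - ⟪gradient f u, v - u⟫)]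

theorem stmt15
    {X : Type*} [NormedAddCommGroup X] [InnerProductSpace ℝ X] [FiniteDimensional ℝ X]
    (f : X → ℝ) (g : X → EReal)
    (hf : ContDiff ℝ 1 f)
    (hg_lsc : LowerSemicontinuous g)
    (hg_proper : ∃ y, g y ≠ ⊤)
    (hq_bddbelow : ∃ c : ℝ, ∀ y, g y ≠ ⊤ → (c : EReal) ≤ (f y : EReal) + g y)
    (hg_affine : ∃ (b : X) (c : ℝ), ∀ y, ((⟪b, y⟫ + c : ℝ) : EReal) ≤ g y)
    (hgrad_lip : LocallyLipschitz (fun y => gradient f y))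
    (hq_cont : ContinuousOn (fun y => (f y : EReal) + g y) {y | g y ≠ ⊤})
    (τ γmin γmax δ : ℝ) (m : ℕ)
    (hτ : 1 < τ) (hγmin : 0 < γmin) (hγminmax : γmin ≤ γmax)
    (hδ : δ ∈ Set.Ioo (0:ℝ) 1)
    (x : ℕ → X) (γ : ℕ → ℝ) (qx : ℕ → ℝ) (l : ℕ → ℕ)
    (hdom : ∀ k, g (x k) ≠ ⊤)
    (hqx : ∀ k, (qx k : EReal) = (f (x k) : EReal) + g (x k))
    (hγlb : ∀ k, γmin ≤ γ k)
    (hl : ∀ k, k - min k m ≤ l k ∧ l k ≤ k ∧ ∀ j ≤ min k m, qx (k - j) ≤ qx (l k))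
    (hstep : ∀ k, ∀ y : X,
      ((f (x k) + ⟪gradient f (x k), x (k + 1) - x k⟫
          + γ k / 2 * ‖x (k + 1) - x k‖ ^ 2 : ℝ) : EReal) + g (x (k + 1))
        ≤ ((f (x k) + ⟪gradient f (x k), y - x k⟫
          + γ k / 2 * ‖y - x k‖ ^ 2 : ℝ) : EReal) + g y)
    (haccept : ∀ k, qx (k + 1) ≤ qx (l k) - δ * γ k / 2 * ‖x (k + 1) - x k‖ ^ 2)
    (htrial : ∀ k, γmax < γ k → ∃ xh : X,
      (∀ y : X, ((f (x k) + ⟪gradient f (x k), xh - x k⟫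
          + (γ k / τ) / 2 * ‖xh - x k‖ ^ 2 : ℝ) : EReal) + g xh
        ≤ ((f (x k) + ⟪gradient f (x k), y - x k⟫
          + (γ k / τ) / 2 * ‖y - x k‖ ^ 2 : ℝ) : EReal) + g y)
      ∧ ((qx (l k) - δ * γ k / (2 * τ) * ‖xh - x k‖ ^ 2 : ℝ) : EReal) < (f xh : EReal) + g xh)
    (xbar : X) (φ : ℕ → ℕ) (hφ : StrictMono φ)
    (hconv : Filter.Tendsto (fun j => x (φ j)) Filter.atTop (nhds xbar)) :
    g xbar ≠ ⊤
    ∧ (0 : X) ∈ ({gradient f xbar} : Set X) + limitingSubdiff g xbar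
    ∧ Filter.Tendsto (fun j => γ (φ j) * ‖x (φ j + 1) - x (φ j)‖) Filter.atTop (nhds 0) := by
  obtain ⟨hδ0, hδ1⟩ := hδ
  have hbot : ∀ y, g y ≠ ⊥ := by
    obtain ⟨b, c, h⟩ := hg_affine
    intro y hy
    have := h y
    rw [hy] at this
    exact EReal.coe_ne_bot _ (le_bot_iff.1 this)
  have hfc : Continuous f := hf.continuous
  have hfd : Differentiable ℝ f := hf.differentiable (by norm_num)
  have hGc : Continuous (fun y => gradient f y) := hgrad_lip.continuous
  have hgx : ∀ k, g (x k) = ((qx k - f (x k) : ℝ) : EReal) := by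
    intro k
    have h1 := hqx k
    induction h : g (x k) with
    | bot => exact absurd h (hbot _)
    | top => exact absurd h (hdom _)
    | coe r =>
      rw [h] at h1
      norm_cast at h1 ⊢
      linarith
  -- monotonicity of the max values
  have hγ0 : ∀ k, 0 < γ k := fun k => hγmin.trans_le (hγlb k)
  have hdec : ∀ k, 0 ≤ δ * γ k / 2 * ‖x (k + 1) - x k‖ ^ 2 := fun k => by
    have := hγ0 k
    positivity
  have hanti : Antitone (fun k => qx (l k)) := by
    apply antitone_nat_of_succ_le
    intro k
    obtain ⟨h1, h2, -⟩ := hl (k + 1)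
    rcases Nat.lt_or_ge k (l (k + 1)) with h | h
    · have : l (k + 1) = k + 1 := by omega
      rw [this]
      linarith [haccept k, hdec k]
    · have := (hl k).2.2 (k - l (k + 1)) (by omega)
      rwa [Nat.sub_sub_self h] at this
  have hle : ∀ k, qx k ≤ qx (l k) := fun k => by simpa using (hl k).2.2 0 (Nat.zero_le _)
  have hB : ∀ k, qx k ≤ qx (l 0) := fun k => (hle k).trans (hanti (Nat.zero_le k))
  obtain ⟨c, hc⟩ := hq_bddbelow
  have hcq : ∀ k, c ≤ qx k := by
    intro k
    have := hc (x k) (hdom k)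
    rw [← hqx k] at this
    exact_mod_cast this
  obtain ⟨Q, hQ⟩ : ∃ Q, Tendsto (fun k => qx (l k)) atTop (𝓝 Q) :=
    ⟨_, tendsto_atTop_ciInf hanti ⟨c, by rintro _ ⟨k, rfl⟩; exact hcq _⟩⟩
  -- limits along filters
  have hlimdom : ∀ (W : Filter ℕ) [NeBot W] (z : X), Tendsto x W (𝓝 z) → g z ≠ ⊤ := by
    intro W _ z hz htop
    have h1 : Tendsto (fun k => qx (l 0) - f (x k)) W (𝓝 (qx (l 0) - f z)) :=
      tendsto_const_nhds.sub ((hfc.tendsto z).comp hz)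
    have h2 := hg_lsc z ((qx (l 0) - f z + 1 : ℝ) : EReal) (by show _ < g z; rw [htop]; exact EReal.coe_lt_top _)
    obtain ⟨k, hk1, hk2⟩ := ((hz.eventually h2).and
      (h1.eventually_le_const (lt_add_one _))).exists
    rw [hgx k, gt_iff_lt, EReal.coe_lt_coe_iff] at hk1
    linarith [hB k]
  have hlimq : ∀ (z : X), g z ≠ ⊤ → ∃ qz : ℝ, g z = ((qz - f z : ℝ) : EReal) ∧
      ∀ (W : Filter ℕ) [NeBot W], Tendsto x W (𝓝 z) → Tendsto qx W (𝓝 qz) := by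
    intro z hz
    lift g z to ℝ using ⟨hz, hbot z⟩ with r hr
    refine ⟨r + f z, by simp, ?_⟩
    intro W _ hW
    have h1 := hq_cont z (by simp [← hr])
    have h2 : Tendsto x W (𝓝[{y | g y ≠ ⊤}] z) :=
      tendsto_nhdsWithin_iff.2 ⟨hW, Eventually.of_forall hdom⟩
    have h3 := h1.tendsto.comp h2
    have e : ((f z : EReal) + g z) = ((r + f z : ℝ) : EReal) := by
      rw [← hr]; norm_cast; ring
    rw [e] at h3
    apply EReal.tendsto_coe.1
    refine h3.congr (fun k => ?_)
    simp only [Function.comp, hqx k]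
  -- boundedness of the steps
  have hbdd : ∀ (W : Filter ℕ) (z : X), Tendsto x W (𝓝 z) →
      ∃ R, ∀ᶠ k in W, ‖x (k + 1) - x k‖ ≤ R := by
    intro W z hW
    obtain ⟨C, M, hC, hM, h⟩ := aux_model f g (fun y => gradient f y) hfc hGc hg_affine x qx _ hB
      hgx W z hW
    refine ⟨max 1 (2 * (C + M) / γmin), ?_⟩
    filter_upwards [h] with k hk
    have h1 := hk (x (k + 1)) (γ k) (hstep k (x k))
    by_contra! hcon
    obtain ⟨ha, hb⟩ := max_lt_iff.1 hcon
    rw [div_lt_iff₀ hγmin] at hb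
    have h2 := hγlb k
    set t := ‖x (k + 1) - x k‖
    have h3 : γmin / 2 * t ^ 2 ≤ γ k / 2 * t ^ 2 := by gcongr
    nlinarith
  -- boundedness of the stepsizes
  have hΓ : ∀ (W : Filter ℕ) (z : X), Tendsto x W (𝓝 z) →
      ∃ Γ, ∀ᶠ k in W, γ k ≤ Γ := by
    intro W z hW
    obtain ⟨C, M, hC, hM, h⟩ := aux_model f g (fun y => gradient f y) hfc hGc hg_affine x qx _ hB
      hgx W z hW
    obtain ⟨L, s, hs, hL⟩ := hgrad_lip z
    obtain ⟨r, hr, hrs⟩ := Metric.mem_nhds_iff.1 hs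
    have hL' := hL.mono hrs
    have hτ0 : 0 < τ := by linarith
    refine ⟨max γmax (max (τ * (2 * (C / (r/2)^2 + M / (r/2)))) (τ * (2 * L / (1 - δ)))), ?_⟩
    filter_upwards [h, hW.eventually (Metric.ball_mem_nhds z (half_pos hr))] with k hk hkz
    by_contra! hcon
    obtain ⟨ha, hb⟩ := max_lt_iff.1 hcon
    obtain ⟨hb, hd⟩ := max_lt_iff.1 hb
    obtain ⟨xh, hx1, hx2⟩ := htrial k ha
    have hm := hk xh (γ k / τ) (hx1 (x k))
    have hm2 := hx1 (x k)
    have e1 : δ * γ k / (2 * τ) = δ * (γ k / τ) / 2 := by field_simp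
    rw [e1] at hx2
    rw [← lt_div_iff₀' hτ0] at hb hd
    generalize γ k / τ = γ' at *
    set t := ‖xh - x k‖ with ht
    have ht0 : 0 ≤ t := norm_nonneg _
    have htr : t < r / 2 := by
      by_contra! hge
      have hr2 : 0 < r / 2 := half_pos hr
      have ht1 : 0 < t := hr2.trans_le hge
      have j1 : C ≤ C / (r/2)^2 * t^2 := by
        rw [div_mul_eq_mul_div, le_div_iff₀ (by positivity)]
        gcongr
      have j2 : M * t ≤ M / (r/2) * t^2 := by
        rw [div_mul_eq_mul_div, le_div_iff₀ (by positivity)]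
        have : M * t * (r/2) ≤ M * t * t := by gcongr
        nlinarith
      have : 0 < t^2 := by positivity
      nlinarith
    have hxh : xh ∈ Metric.ball z r := by
      rw [Metric.mem_ball]
      have := dist_triangle xh (x k) z
      rw [dist_eq_norm xh (x k)] at this
      linarith
    have hxk : x k ∈ Metric.ball z r := Metric.ball_subset_ball (by linarith) hkz
    have hdes := aux_descent f hfd _ (convex_ball z r) L hL' (x k) xh hxk hxh
    rw [hgx k] at hm2
    rw [← ht] at hdes
    rw [div_lt_iff₀ (by linarith)] at hd
    induction hgy : g xh with
    | bot => exact absurd hgy (hbot _)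
    | top =>
      rw [hgy] at hm2
      rw [EReal.coe_add_top] at hm2
      norm_cast at hm2
    | coe a =>
      rw [hgy] at hm2 hx2
      norm_cast at hm2 hx2
      simp only [sub_self, inner_zero_right, norm_zero] at hm2
      have := hle k
      nlinarith [sq_nonneg t]
  -- the key step
  have hacc : ∀ (W : Filter ℕ), W ≤ atTop → Tendsto (fun k => qx (k + 1)) W (𝓝 Q) →
      Tendsto (fun k => ‖x (k + 1) - x k‖) W (𝓝 0) := by
    intro W hW h
    have h1 : Tendsto (fun k => (qx (l k) - qx (k + 1)) / (δ * γmin / 2)) W (𝓝 0) := by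
      have := ((hQ.mono_left hW).sub h).div_const (δ * γmin / 2)
      simpa using this
    have h2 : Tendsto (fun k => ‖x (k + 1) - x k‖ ^ 2) W (𝓝 0) := by
      refine squeeze_zero (fun k => by positivity) (fun k => ?_) h1
      rw [le_div_iff₀ (by positivity)]
      have h3 : δ * γmin / 2 * ‖x (k + 1) - x k‖ ^ 2 ≤ δ * γ k / 2 * ‖x (k + 1) - x k‖ ^ 2 := by
        have := hγlb k
        gcongr
      linarith [haccept k]
    have h4 := h2.sqrt
    simpa using h4
  have hshift : ∀ i : ℕ, Tendsto (fun k : ℕ => k + i) atTop atTop := fun i => tendsto_add_atTop_nat i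
  have hback : ∀ (W : Filter ℕ) [NeBot W], W ≤ atTop →
      (∀ i, ∃ z, Tendsto (fun k => x (k + i)) W (𝓝 z)) →
      ∀ i, Tendsto (fun k => qx (k + (i + 1))) W (𝓝 Q) →
        Tendsto (fun k => ‖x (k + 1) - x k‖) W (𝓝 0) := by
    intro W _ hW hz i
    induction i with
    | zero => intro h; exact hacc W hW h
    | succ i ih =>
      intro h
      apply ih
      have h1 : Tendsto (fun k => ‖x (k + (i + 1) + 1) - x (k + (i + 1))‖) W (𝓝 0) := by
        have := hacc (map (fun k => k + (i + 1)) W) ((map_mono hW).trans (hshift (i + 1)))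
          (tendsto_map'_iff.2 h)
        exact tendsto_map'_iff.1 this
      obtain ⟨z, hz1⟩ := hz (i + 1)
      have h2 : Tendsto (fun k => x (k + (i + 1 + 1))) W (𝓝 z) := by
        have := (tendsto_zero_iff_norm_tendsto_zero.2 h1).add hz1
        simp only [sub_add_cancel, zero_add] at this
        exact this
      have hz1' : Tendsto x (map (fun k => k + (i + 1)) W) (𝓝 z) := tendsto_map'_iff.2 hz1
      have hz2' : Tendsto x (map (fun k => k + (i + 1 + 1)) W) (𝓝 z) := tendsto_map'_iff.2 h2
      obtain ⟨qz, -, hqz⟩ := hlimq z (hlimdom _ z hz1')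
      have k1 := tendsto_map'_iff.1 (hqz _ hz1')
      have k2 := tendsto_map'_iff.1 (hqz _ hz2')
      have : qz = Q := tendsto_nhds_unique k2 h
      rw [← this]
      exact k1
  have hultra : ∀ (W : Ultrafilter ℕ), (W : Filter ℕ) ≤ atTop → (∃ z, Tendsto x W (𝓝 z)) →
      Tendsto (fun k => ‖x (k + 1) - x k‖) W (𝓝 0) := by
    intro W hW hz
    have hall : ∀ i, ∃ z, Tendsto (fun k => x (k + i)) W (𝓝 z) := by
      intro i
      induction i with
      | zero => exact hz
      | succ i ih =>
        obtain ⟨z, hz⟩ := ih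
        obtain ⟨R, hR⟩ := hbdd (map (fun k => k + i) W) z (tendsto_map'_iff.2 hz)
        rw [eventually_map] at hR
        have hbig : ∀ᶠ k in (W : Filter ℕ), x (k + (i + 1)) ∈ Metric.closedBall z (R + 1) := by
          filter_upwards [hR, hz.eventually (Metric.ball_mem_nhds z one_pos)] with k hk1 hk2
          rw [Metric.mem_closedBall]
          have := dist_triangle (x (k + (i + 1))) (x (k + i)) z
          rw [dist_eq_norm (x (k + (i + 1))) (x (k + i))] at this
          have : ‖x (k + (i + 1)) - x (k + i)‖ ≤ R := hk1
          linarith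
        have := isCompact_iff_ultrafilter_le_nhds'.1 (isCompact_closedBall z (R + 1))
          (W.map (fun k => x (k + (i + 1)))) hbig
        obtain ⟨z', -, hz'⟩ := this
        exact ⟨z', hz'⟩
    have hpig : ∃ i ∈ Set.Iic m, ∀ᶠ k in (W : Filter ℕ), l (k + (m + 1)) = k + (i + 1) := by
      have : ∀ᶠ k in (W : Filter ℕ), ∃ i ∈ Set.Iic m, l (k + (m + 1)) = k + (i + 1) := by
        refine Eventually.of_forall fun k => ?_
        obtain ⟨h1, h2, -⟩ := hl (k + (m + 1))
        refine ⟨l (k + (m + 1)) - (k + 1), ?_, ?_⟩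
        · simp only [Set.mem_Iic]; omega
        · omega
      exact (Ultrafilter.eventually_exists_mem_iff (Set.finite_Iic m)).1 this
    obtain ⟨i, -, hi⟩ := hpig
    apply hback W hW hall i
    have := hQ.comp ((hshift (m + 1)).mono_left hW)
    refine this.congr' ?_
    filter_upwards [hi] with k hk
    simp only [Function.comp, hk]
  -- conclusion
  have hφt := hφ.tendsto_atTop
  have hstep0 : Tendsto (fun j => ‖x (φ j + 1) - x (φ j)‖) atTop (𝓝 0) := by
    rw [tendsto_iff_ultrafilter]
    intro U hU
    have := hultra (U.map φ) ((map_mono hU).trans hφt)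
      ⟨xbar, tendsto_map'_iff.2 (hconv.mono_left hU)⟩
    exact tendsto_map'_iff.1 this
  have hx1 : Tendsto (fun j => x (φ j + 1)) atTop (𝓝 xbar) := by
    have := (tendsto_zero_iff_norm_tendsto_zero.2 hstep0).add hconv
    simpa using this
  have hconv' : Tendsto x (map φ atTop) (𝓝 xbar) := tendsto_map'_iff.2 hconv
  have hx1' : Tendsto x (map (fun j => φ j + 1) atTop) (𝓝 xbar) := tendsto_map'_iff.2 hx1
  have hfin := hlimdom _ xbar hconv'
  have hprod : Tendsto (fun j => γ (φ j) * ‖x (φ j + 1) - x (φ j)‖) atTop (𝓝 0) := by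
    obtain ⟨Γ, hΓ1⟩ := hΓ _ xbar hconv'
    rw [eventually_map] at hΓ1
    have h1 : Tendsto (fun j => Γ * ‖x (φ j + 1) - x (φ j)‖) atTop (𝓝 0) := by
      simpa using hstep0.const_mul Γ
    refine squeeze_zero' (Eventually.of_forall fun j => ?_) ?_ h1
    · have := hγ0 (φ j)
      positivity
    · filter_upwards [hΓ1] with j hj
      gcongr
  refine ⟨hfin, ?_, hprod⟩
  rw [Set.mem_add]
  refine ⟨_, rfl, - gradient f xbar, ?_, by simp⟩
  obtain ⟨qz, hgz, hqz⟩ := hlimq xbar hfin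
  refine ⟨fun j => x (φ j + 1),
    fun j => - gradient f (x (φ j)) - γ (φ j) • (x (φ j + 1) - x (φ j)), hx1, ?_, ?_, ?_⟩
  · rw [hgz]
    simp only [hgx]
    apply EReal.tendsto_coe.2
    exact (tendsto_map'_iff.1 (hqz _ hx1')).sub ((hfc.tendsto xbar).comp hx1)
  · have h1 : Tendsto (fun j => γ (φ j) • (x (φ j + 1) - x (φ j))) atTop (𝓝 0) := by
      rw [tendsto_zero_iff_norm_tendsto_zero]
      refine hprod.congr fun j => ?_
      rw [norm_smul, Real.norm_of_nonneg (hγ0 _).le]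
    have h2 := (((hGc.tendsto xbar).comp hconv).neg).sub h1
    simpa using h2
  · intro j
    exact aux_frechet g (x (φ j + 1)) (gradient f (x (φ j))) 0 (f (x (φ j))) (γ (φ j)) _ (x (φ j))
      (hgx _) hbot (hstep (φ j))
end

section
/- If some subsequence (x^k)_{k ∈ K} of the iterates of the NPG method with max line search converges to a point x̄ and q has the KL property at x̄, then the entire sequence (x^k) converges to x̄. -/
open Filter Topology Set Metric Pointwise RealInnerProductSpace

/-- `χ` (with derivative `χ'` on `(0, η)`) is a desingularization function witnessing the
Kurdyka-Łojasiewicz property of `q` at `xb` with constant `η`. -/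
noncomputable def IsKLDesingularizer {X : Type*} [NormedAddCommGroup X] [InnerProductSpace ℝ X]
    (q : X → EReal) (xb : X) (η : ℝ) (χ χ' : ℝ → ℝ) : Prop :=
  0 < η ∧ χ 0 = 0 ∧ (∀ t ∈ Set.Icc 0 η, 0 ≤ χ t) ∧
  ContinuousOn χ (Set.Icc 0 η) ∧ ConcaveOn ℝ (Set.Icc 0 η) χ ∧
  ContinuousOn χ' (Set.Ioo 0 η) ∧
  (∀ t ∈ Set.Ioo 0 η, HasDerivAt χ (χ' t) t ∧ 0 < χ' t) ∧
  ∃ U ∈ nhds xb, ∀ y ∈ U, q xb < q y → q y < q xb + (η : EReal) →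
    1 ≤ ENNReal.ofReal (χ' ((q y - q xb).toReal)) * EMetric.infEdist (0 : X) (limitingSubdiff q y)

/-- `q` has the Kurdyka-Łojasiewicz property at `xb`. -/
noncomputable def HasKLProperty {X : Type*} [NormedAddCommGroup X] [InnerProductSpace ℝ X]
    (q : X → EReal) (xb : X) : Prop :=
  ∃ (η : ℝ) (χ χ' : ℝ → ℝ), IsKLDesingularizer q xb η χ χ'

lemma npg_lyap {X : Type*} [NormedAddCommGroup X] (x : ℕ → X) (xb : X) (W : ℕ → ℝ) (C r : ℝ)
    (N : ℕ) (hC : 0 < C) (hr : 0 < r) (hW : ∀ k ≥ N, 0 ≤ W k) (hWt : Tendsto W atTop (𝓝 0))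
    (hs : ∀ k ≥ N, ‖x k - xb‖ ≤ r → ‖x (k + 1) - x k‖ ≤ C * (W k - W (k + 1)))
    (φ : ℕ → ℕ) (hφ : StrictMono φ) (hconv : Tendsto (fun j => x (φ j)) atTop (𝓝 xb)) :
    Tendsto x atTop (𝓝 xb) := by
  rw [Metric.tendsto_atTop]
  intro ε hε
  obtain ⟨ρ, hρ0, hρr, hρε⟩ : ∃ ρ > 0, ρ ≤ r ∧ ρ < ε :=
    ⟨min r (ε / 2), lt_min hr (by linarith), min_le_left _ _,
      lt_of_le_of_lt (min_le_right _ _) (by linarith)⟩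
  have h1 : ∀ᶠ j in atTop, ‖x (φ j) - xb‖ < ρ / 2 := by
    have := (Metric.tendsto_nhds.1 hconv) (ρ / 2) (by linarith)
    simpa [dist_eq_norm] using this
  have h2 : ∀ᶠ j in atTop, W (φ j) < ρ / (2 * C) :=
    hφ.tendsto_atTop.eventually (hWt.eventually (gt_mem_nhds (by positivity)))
  have h3 : ∀ᶠ j in atTop, N ≤ φ j := hφ.tendsto_atTop.eventually (eventually_ge_atTop N)
  obtain ⟨j, hj1, hj2, hj3⟩ := (h1.and (h2.and h3)).exists
  have hCW : C * W (φ j) < ρ / 2 := by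
    rw [lt_div_iff₀ (by positivity)] at hj2
    linarith
  have key : ∀ n, ‖x (φ j + n) - x (φ j)‖ ≤ C * (W (φ j) - W (φ j + n)) ∧
      ‖x (φ j + n) - xb‖ ≤ ρ := by
    intro n
    induction n with
    | zero => simp; linarith
    | succ n ih =>
      have hst := hs (φ j + n) (by omega) (ih.2.trans hρr)
      have e1 : ‖x (φ j + (n + 1)) - x (φ j)‖ ≤ C * (W (φ j) - W (φ j + (n + 1))) := by
        have := norm_sub_le_norm_sub_add_norm_sub (x (φ j + (n + 1))) (x (φ j + n)) (x (φ j))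
        have e := ih.1
        rw [← add_assoc] at this ⊢
        nlinarith
      refine ⟨e1, ?_⟩
      have := norm_sub_le_norm_sub_add_norm_sub (x (φ j + (n + 1))) (x (φ j)) xb
      have hw := mul_nonneg hC.le (hW (φ j + (n + 1)) (by omega))
      nlinarith
  refine ⟨φ j, fun k hk => ?_⟩
  obtain ⟨n, rfl⟩ := Nat.exists_eq_add_of_le hk
  rw [dist_eq_norm]
  exact lt_of_le_of_lt (key n).2 hρε

lemma npg_back (qx Q D : ℕ → ℝ) (a L : ℝ) (k j : ℕ) (Δ : ℝ) (ha : 0 < a) (hL : 0 ≤ L)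
    (hQ : Antitone Q) (hkj : k + 1 ≤ j)
    (h1 : ∀ i, a * D i ^ 2 ≤ Q i - qx (i + 1))
    (h2 : ∀ i, k ≤ i → i < j → qx (i + 1) ≤ qx i + L * D i ^ 2)
    (hj : Q k - qx j ≤ Δ) : 
    ∀ i p, p + i = j → k + 1 ≤ p → Q k - qx p ≤ (1 + L / a) ^ i * Δ := by
  intro i
  induction i with
  | zero => intro p hp _; simp at hp; subst hp; simpa using hj
  | succ i ih =>
    intro p hp hkp
    have e := ih (p + 1) (by omega) (by omega)
    have e1 := h1 p
    have e2 := h2 p (by omega) (by omega)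
    have e3 := hQ (show k ≤ p by omega)
    have e4 : D p ^ 2 ≤ (Q k - qx (p + 1)) / a := by
      rw [le_div_iff₀ ha]; linarith
    have e5 : L * D p ^ 2 ≤ L * ((Q k - qx (p + 1)) / a) := mul_le_mul_of_nonneg_left e4 hL
    have e6 : Q k - qx p ≤ (1 + L / a) * (Q k - qx (p + 1)) := by
      have : (1 + L / a) * (Q k - qx (p + 1)) = (Q k - qx (p + 1)) + L * ((Q k - qx (p + 1)) / a) := by
        ring
      linarith
    have hB : 0 ≤ 1 + L / a := by positivity
    calc _ ≤ _ := e6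
      _ ≤ (1 + L / a) * ((1 + L / a) ^ i * Δ) := mul_le_mul_of_nonneg_left e hB
      _ = _ := by ring

lemma npg_descent {X : Type*} [NormedAddCommGroup X] [InnerProductSpace ℝ X]
    [FiniteDimensional ℝ X] (f : X → ℝ) (hf : ContDiff ℝ 1 f) (xb : X) (ρ L : ℝ) (hL : 0 ≤ L)
    (hlip : ∀ u ∈ ball xb ρ, ∀ v ∈ ball xb ρ, ‖gradient f u - gradient f v‖ ≤ L * ‖u - v‖)
    (u v : X) (hu : u ∈ ball xb ρ) (hv : v ∈ ball xb ρ) :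
    f v ≤ f u + ⟪gradient f u, v - u⟫ + L * ‖v - u‖ ^ 2 := by
  have hd : ∀ z, HasFDerivAt f ((InnerProductSpace.toDual ℝ X) (gradient f z)) z := fun z =>
    ((hf.differentiable (by norm_num)) z).hasGradientAt.hasFDerivAt
  have hsub : segment ℝ u v ⊆ ball xb ρ := (convex_ball xb ρ).segment_subset hu hv
  have := Convex.norm_image_sub_le_of_norm_hasFDerivWithin_le' (𝕜 := ℝ) (f := f)
    (C := L * ‖v - u‖) (s := segment ℝ u v) (x := u) (y := v)
    (f' := fun z => (InnerProductSpace.toDual ℝ X) (gradient f z))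
    (φ := (InnerProductSpace.toDual ℝ X) (gradient f u))
    (fun z _ => (hd z).hasFDerivWithinAt) ?_ (convex_segment u v) (left_mem_segment ℝ u v)
    (right_mem_segment ℝ u v)
  · rw [InnerProductSpace.toDual_apply_apply, Real.norm_eq_abs] at this
    have := (abs_le.1 this).2
    nlinarith
  · intro z hz
    rw [← map_sub, LinearIsometryEquiv.norm_map]
    refine (hlip z (hsub hz) u hu).trans (mul_le_mul_of_nonneg_left ?_ hL)
    obtain ⟨s, t, hs, ht, hst, rfl⟩ := hz
    have : s • u + t • v - u = t • (v - u) := by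
      have : s = 1 - t := by linarith
      subst this
      module
    rw [this, norm_smul, Real.norm_of_nonneg ht]
    exact mul_le_of_le_one_left (norm_nonneg _) (by linarith)

lemma npg_frechet {X : Type*} [NormedAddCommGroup X] [InnerProductSpace ℝ X]
    [FiniteDimensional ℝ X] (f : X → ℝ) (g : X → EReal) (hf : ContDiff ℝ 1 f)
    (u v : X) (β G : ℝ) (hG : g v = (G : EReal))
    (hstep : ∀ y : X,
      ((f u + ⟪gradient f u, v - u⟫ + β / 2 * ‖v - u‖ ^ 2 : ℝ) : EReal) + g v
        ≤ ((f u + ⟪gradient f u, y - u⟫ + β / 2 * ‖y - u‖ ^ 2 : ℝ) : EReal) + g y) :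
    gradient f v - gradient f u - β • (v - u) ∈
      frechetSubdiff (fun y => (f y : EReal) + g y) v := by
  set w := gradient f v - gradient f u - β • (v - u) with hw
  have hgr := hasGradientAt_iff_isLittleO.1
    ((hf.differentiable (by norm_num)) v).hasGradientAt
  have key : ∀ ε : ℝ, 0 < ε → ((-ε : ℝ) : EReal) ≤ Filter.liminf
      (fun y => (((f y : EReal) + g y) - ((f v : EReal) + g v) - ((⟪w, y - v⟫ : ℝ) : EReal)) /
        ((‖y - v‖ : ℝ) : EReal)) (nhdsWithin v {v}ᶜ) := by
    intro ε hε
    refine le_liminf_of_le (by isBoundedDefault) ?_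
    have e1 := hgr.def (half_pos hε)
    have e2 : ∀ᶠ y in 𝓝 v, |β| * ‖y - v‖ < ε := by
      have : Tendsto (fun y => |β| * ‖y - v‖) (𝓝 v) (𝓝 (|β| * ‖v - v‖)) :=
        Continuous.tendsto (by fun_prop) v
      simp only [sub_self, norm_zero, mul_zero] at this
      exact this.eventually (gt_mem_nhds hε)
    filter_upwards [e1.filter_mono nhdsWithin_le_nhds, e2.filter_mono nhdsWithin_le_nhds,
      self_mem_nhdsWithin] with y h1 h2 h3
    have hn : 0 < ‖y - v‖ := norm_pos_iff.2 (sub_ne_zero.2 h3)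
    rw [EReal.le_div_iff_mul_le (by exact_mod_cast hn) (EReal.coe_ne_top _)]
    have hy : ((f u + ⟪gradient f u, v - u⟫ + β / 2 * ‖v - u‖ ^ 2 + G
        - (f u + ⟪gradient f u, y - u⟫ + β / 2 * ‖y - u‖ ^ 2) : ℝ) : EReal) ≤ g y := by
      have := hstep y
      rw [hG] at this
      rw [EReal.coe_sub]
      apply EReal.sub_le_of_le_add'
      rw [EReal.coe_add]
      exact this
    have hq := add_le_add (le_refl (f y : EReal)) hy
    have hq2 := EReal.sub_le_sub (EReal.sub_le_sub hq (le_refl ((f v : EReal) + g v)))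
      (le_refl ((⟪w, y - v⟫ : ℝ) : EReal))
    refine le_trans ?_ hq2
    rw [hG]
    norm_cast
    rw [Real.norm_eq_abs] at h1
    have h1' := (abs_le.1 h1).1
    have ea : y - u = (y - v) + (v - u) := by abel
    have eb : ‖y - u‖ ^ 2 = ‖y - v‖ ^ 2 + 2 * ⟪y - v, v - u⟫ + ‖v - u‖ ^ 2 := by
      rw [ea, norm_add_sq_real]
    have ec : ⟪gradient f u, y - u⟫ = ⟪gradient f u, y - v⟫ + ⟪gradient f u, v - u⟫ := by
      rw [ea, inner_add_right]
    have ed : ⟪w, y - v⟫ = ⟪gradient f v, y - v⟫ - ⟪gradient f u, y - v⟫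
        - β * ⟪y - v, v - u⟫ := by
      rw [hw, inner_sub_left, inner_sub_left, real_inner_smul_left, real_inner_comm (y - v) (v - u)]
    rw [eb, ec, ed]
    have : β * ‖y - v‖ ^ 2 ≤ ε * ‖y - v‖ := by
      have := le_abs_self β
      nlinarith [mul_le_mul_of_nonneg_right this hn.le]
    nlinarith
  change (0 : EReal) ≤ _
  refine le_of_forall_lt fun c hc => ?_
  obtain ⟨r, hr1, hr2⟩ := EReal.lt_iff_exists_real_btwn.1 hc
  refine lt_of_lt_of_le hr1 ?_
  have := key (-r) (by have : r < 0 := by exact_mod_cast hr2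
                       linarith)
  simpa using this

lemma npg_KL {X : Type*} [NormedAddCommGroup X] [InnerProductSpace ℝ X]
    (q : X → EReal) (y w : X) (c : ℝ) (hc : 0 < c) (hw : w ∈ frechetSubdiff q y)
    (h : 1 ≤ ENNReal.ofReal c * EMetric.infEdist (0 : X) (limitingSubdiff q y)) :
    1 ≤ c * ‖w‖ := by
  have hm : w ∈ limitingSubdiff q y :=
    ⟨fun _ => y, fun _ => w, tendsto_const_nhds, tendsto_const_nhds, tendsto_const_nhds,
      fun _ => hw⟩
  have h1 : EMetric.infEdist (0 : X) (limitingSubdiff q y) ≤ ENNReal.ofReal ‖w‖ := by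
    refine (Metric.infEDist_le_edist_of_mem hm).trans ?_
    rw [edist_dist, dist_zero_left]
  have h2 : (1 : ENNReal) ≤ ENNReal.ofReal (c * ‖w‖) := by
    rw [ENNReal.ofReal_mul hc.le]
    exact h.trans (by gcongr)
  simpa using h2

lemma npg_stepbound {X : Type*} [NormedAddCommGroup X] [InnerProductSpace ℝ X]
    [FiniteDimensional ℝ X] (f : X → ℝ) (g : X → EReal) (hf : ContDiff ℝ 1 f)
    (hgc : Continuous (fun y => gradient f y))
    (hg_affine : ∃ (b : X) (c : ℝ), ∀ y, ((⟪b, y⟫ + c : ℝ) : EReal) ≤ g y) (R q0 : ℝ) :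
    ∃ A : ℝ, 0 ≤ A ∧ ∀ (u z : X) (β q : ℝ), ‖u‖ ≤ R → g u = ((q - f u : ℝ) : EReal) → q ≤ q0 →
      ((f u + ⟪gradient f u, z - u⟫ + β / 2 * ‖z - u‖ ^ 2 : ℝ) : EReal) + g z
        ≤ ((f u + ⟪gradient f u, u - u⟫ + β / 2 * ‖u - u‖ ^ 2 : ℝ) : EReal) + g u →
      β / 2 * ‖z - u‖ ^ 2 ≤ A + A * ‖z - u‖ := by
  obtain ⟨b, c, hb⟩ := hg_affine
  have hK : IsCompact (closedBall (0 : X) R) := isCompact_closedBall 0 R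
  obtain ⟨A1, hA1⟩ := hK.exists_bound_of_continuousOn hf.continuous.continuousOn
  obtain ⟨A2, hA2⟩ := hK.exists_bound_of_continuousOn hgc.continuousOn
  refine ⟨|q0| + |A1| + |A2| + ‖b‖ * |R| + ‖b‖ + |c|, by positivity, ?_⟩
  intro u z β q hu hgu hq hz
  have hu' : u ∈ closedBall (0 : X) R := by simpa using hu
  have a1 := hA1 u hu'
  have a2 := hA2 u hu'
  have hz' : ((f u + ⟪gradient f u, z - u⟫ + β / 2 * ‖z - u‖ ^ 2 : ℝ) : EReal) +
      ((⟪b, z⟫ + c : ℝ) : EReal) ≤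
      ((f u + ⟪gradient f u, u - u⟫ + β / 2 * ‖u - u‖ ^ 2 : ℝ) : EReal) + g u :=
    (add_le_add le_rfl (hb z)).trans hz
  rw [hgu] at hz'
  norm_cast at hz'
  simp only [sub_self, inner_zero_right, norm_zero] at hz'
  have e1 := abs_le.1 (abs_real_inner_le_norm (gradient f u) (z - u))
  have e2 := abs_le.1 (abs_real_inner_le_norm b (z - u))
  have e3 := abs_le.1 (abs_real_inner_le_norm b u)
  have e4 : ⟪b, z⟫ = ⟪b, z - u⟫ + ⟪b, u⟫ := by rw [← inner_add_right]; simp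
  have e5 : ‖gradient f u‖ * ‖z - u‖ ≤ |A2| * ‖z - u‖ :=
    mul_le_mul_of_nonneg_right (a2.trans (le_abs_self _)) (norm_nonneg _)
  have e6 : ‖b‖ * ‖u‖ ≤ ‖b‖ * |R| :=
    mul_le_mul_of_nonneg_left (hu.trans (le_abs_self _)) (norm_nonneg _)
  have e7 := abs_le.1 (show |f u| ≤ |A1| from a1.trans (le_abs_self _))
  have e8 := le_abs_self q0
  have e9 := neg_abs_le c
  have p1 : 0 ≤ |q0| * ‖z - u‖ := by positivity
  have p2 : 0 ≤ |A1| * ‖z - u‖ := by positivity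
  have p3 : 0 ≤ ‖b‖ * |R| * ‖z - u‖ := by positivity
  have p4 : 0 ≤ |c| * ‖z - u‖ := by positivity
  have p5 := abs_nonneg A2
  have p6 := norm_nonneg b
  rw [e4] at hz'
  nlinarith

lemma npg_bdd_conv {X : Type*} [NormedAddCommGroup X] [ProperSpace X] (U : Ultrafilter ℕ)
    (s : ℕ → X) (R : ℝ) (h : ∀ᶠ k in (U : Filter ℕ), ‖s k‖ ≤ R) :
    ∃ y, Tendsto s U (𝓝 y) := by
  obtain ⟨y, _, hy⟩ := (isCompact_closedBall (0 : X) R).ultrafilter_le_nhds (U.map s) (by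
    rw [le_principal_iff]
    change ∀ᶠ k in (U : Filter ℕ), s k ∈ closedBall (0 : X) R
    simpa using h)
  exact ⟨y, hy⟩

lemma npg_ultraA {X : Type*} [NormedAddCommGroup X] [ProperSpace X] (x : ℕ → X)
    (qx Q : ℕ → ℝ) (m : ℕ) (a qs : ℝ) (ha : 0 < a) (hQt : Tendsto Q atTop (𝓝 qs))
    (h1 : ∀ i, a * ‖x (i + 1) - x i‖ ^ 2 ≤ Q i - qx (i + 1))
    (hbd : ∀ R, ∃ R', ∀ k, ‖x k‖ ≤ R → ‖x (k + 1)‖ ≤ R') (qr : X → ℝ)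
    (hcont : ∀ (U : Ultrafilter ℕ) (s : ℕ → ℕ) (y : X), Tendsto (fun k => x (s k)) U (𝓝 y) →
      Tendsto (fun k => qx (s k)) U (𝓝 (qr y)))
    (hl : ∀ k, ∃ i ∈ Iic m, qx (k + 1 + i) = Q (k + m + 1))
    (U : Ultrafilter ℕ) (hU : (U : Filter ℕ) ≤ atTop) (R : ℝ)
    (hR : ∀ᶠ k in (U : Filter ℕ), ‖x k‖ ≤ R) : Tendsto qx U (𝓝 qs) := by
  have hb : ∀ i, ∃ R', ∀ᶠ k in (U : Filter ℕ), ‖x (k + i)‖ ≤ R' := by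
    intro i
    induction i with
    | zero => exact ⟨R, hR⟩
    | succ i ih =>
      obtain ⟨R1, h1⟩ := ih
      obtain ⟨R2, h2⟩ := hbd R1
      exact ⟨R2, h1.mono fun k hk => h2 _ hk⟩
  have hc : ∀ i, ∃ y, Tendsto (fun k => x (k + i)) U (𝓝 y) := fun i => by
    obtain ⟨R', h⟩ := hb i
    exact npg_bdd_conv U _ R' h
  have hQi : ∀ i, Tendsto (fun k => Q (k + i)) U (𝓝 qs) := fun i =>
    (hQt.comp (tendsto_add_atTop_nat i)).mono_left hU
  have back : ∀ i, Tendsto (fun k => qx (k + (i + 1))) U (𝓝 qs) →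
      Tendsto (fun k => qx (k + i)) U (𝓝 qs) := by
    intro i hi
    obtain ⟨y, hy⟩ := hc i
    obtain ⟨z, hz⟩ := hc (i + 1)
    have hd : Tendsto (fun k => a * ‖x (k + (i + 1)) - x (k + i)‖ ^ 2) U
        (𝓝 (a * ‖z - y‖ ^ 2)) := ((hz.sub hy).norm.pow 2).const_mul a
    have hle : a * ‖z - y‖ ^ 2 ≤ qs - qs :=
      le_of_tendsto_of_tendsto' hd ((hQi i).sub hi) fun k => h1 (k + i)
    have hzy : z = y := by
      rw [sub_self] at hle
      have : ‖z - y‖ ^ 2 ≤ 0 := by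
        by_contra hcon
        push Not at hcon
        have := mul_pos ha hcon
        linarith
      have : ‖z - y‖ = 0 := by nlinarith [norm_nonneg (z - y)]
      exact sub_eq_zero.1 (norm_eq_zero.1 this)
    have e1 := hcont U _ z hz
    have e2 := hcont U _ y hy
    rw [hzy] at e1
    rw [tendsto_nhds_unique hi e1]
    exact e2
  have down : ∀ i, Tendsto (fun k => qx (k + i)) U (𝓝 qs) → Tendsto qx U (𝓝 qs) := by
    intro i
    induction i with
    | zero => exact id
    | succ i ih => exact fun h => ih (back i h)
  obtain ⟨i, _, hi⟩ := (Ultrafilter.eventually_exists_mem_iff (f := U) (finite_Iic m)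
    (P := fun i k => qx (k + 1 + i) = Q (k + m + 1))).1 (Eventually.of_forall hl)
  refine down (1 + i) ?_
  have := hQi (m + 1)
  refine this.congr' ?_
  filter_upwards [hi] with k hk
  rw [← add_assoc, ← add_assoc]
  exact hk.symm

lemma npg_small {X : Type*} [NormedAddCommGroup X] [ProperSpace X] (x : ℕ → X)
    (qx Q : ℕ → ℝ) (m : ℕ) (a qs : ℝ) (ha : 0 < a) (hQt : Tendsto Q atTop (𝓝 qs))
    (h1 : ∀ i, a * ‖x (i + 1) - x i‖ ^ 2 ≤ Q i - qx (i + 1))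
    (hbd : ∀ R, ∃ R', ∀ k, ‖x k‖ ≤ R → ‖x (k + 1)‖ ≤ R') (qr : X → ℝ)
    (hcont : ∀ (U : Ultrafilter ℕ) (s : ℕ → ℕ) (y : X), Tendsto (fun k => x (s k)) U (𝓝 y) →
      Tendsto (fun k => qx (s k)) U (𝓝 (qr y)))
    (hl : ∀ k, ∃ i ∈ Iic m, qx (k + 1 + i) = Q (k + m + 1))
    (R ε : ℝ) (hε : 0 < ε) : ∀ᶠ k in atTop, ‖x k‖ ≤ R → ‖x (k + 1) - x k‖ ≤ ε := by
  by_contra hcon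
  replace hcon : ∃ᶠ k in atTop, ‖x k‖ ≤ R ∧ ε < ‖x (k + 1) - x k‖ := by
    intro h
    refine hcon (h.mono fun k hk hk1 => ?_)
    by_contra hk2
    exact hk ⟨hk1, not_le.1 hk2⟩
  rw [frequently_iff_neBot] at hcon
  set U := Ultrafilter.of (atTop ⊓ 𝓟 {k | ‖x k‖ ≤ R ∧ ε < ‖x (k + 1) - x k‖}) with hUdef
  have hUle := Ultrafilter.of_le (atTop ⊓ 𝓟 {k | ‖x k‖ ≤ R ∧ ε < ‖x (k + 1) - x k‖})
  rw [← hUdef] at hUle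
  have hU : (U : Filter ℕ) ≤ atTop := hUle.trans inf_le_left
  have hS : ∀ᶠ k in (U : Filter ℕ), ‖x k‖ ≤ R ∧ ε < ‖x (k + 1) - x k‖ :=
    le_principal_iff.1 (hUle.trans inf_le_right)
  obtain ⟨R', hR'⟩ := hbd R
  have hA := npg_ultraA x qx Q m a qs ha hQt h1 hbd qr hcont hl (U.map (fun k => k + 1))
    ((Filter.map_mono hU).trans (tendsto_add_atTop_nat 1)) R'
    (by
      change ∀ᶠ k in (U : Filter ℕ), ‖x (k + 1)‖ ≤ R'
      exact hS.mono fun k hk => hR' k hk.1)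
  have hA' : Tendsto (fun k => qx (k + 1)) U (𝓝 qs) := hA
  have h0 : a * ε ^ 2 ≤ qs - qs := by
    refine ge_of_tendsto ((hQt.mono_left hU).sub hA') ?_
    filter_upwards [hS] with k hk
    refine le_trans ?_ (h1 k)
    have := hk.2
    gcongr
  have : 0 < a * ε ^ 2 := by positivity
  linarith

lemma npg_cont {X : Type*} [NormedAddCommGroup X] 
    (f : X → ℝ) (g : X → EReal) (hf : Continuous f) (hg_lsc : LowerSemicontinuous g)
    (hbot : ∀ y, g y ≠ ⊥)
    (hq_cont : ContinuousOn (fun y => (f y : EReal) + g y) {y | g y ≠ ⊤})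
    (x : ℕ → X) (qx : ℕ → ℝ) (q0 : ℝ) (hG : ∀ k, g (x k) = ((qx k - f (x k) : ℝ) : EReal))
    (hq0 : ∀ k, qx k ≤ q0) (U : Ultrafilter ℕ) (s : ℕ → ℕ) (y : X)
    (hs : Tendsto (fun k => x (s k)) U (𝓝 y)) : g y ≠ ⊤ ∧
      Tendsto (fun k => qx (s k)) U (𝓝 ((f y : EReal) + g y).toReal) := by
  have hy : g y ≠ ⊤ := by
    intro htop
    have e1 := hs.eventually (hg_lsc y ((q0 - f y + 1 : ℝ) : EReal) (by
      change _ < g y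
      rw [htop]
      exact EReal.coe_lt_top _))
    have e2 : ∀ᶠ k in (U : Filter ℕ), f y - 1 < f (x (s k)) :=
      ((hf.tendsto y).comp hs).eventually (lt_mem_nhds (by linarith))
    obtain ⟨k, h1, h2⟩ := (e1.and e2).exists
    rw [hG] at h1
    have h1 := EReal.coe_lt_coe_iff.1 h1
    have := hq0 (s k)
    linarith
  refine ⟨hy, ?_⟩
  have hc := hq_cont y hy
  have ht : Tendsto (fun k => x (s k)) U (𝓝[{y | g y ≠ ⊤}] y) :=
    tendsto_nhdsWithin_iff.2 ⟨hs, Eventually.of_forall fun k => by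
      simp only [Set.mem_ofPred_eq, hG]; exact EReal.coe_ne_top _⟩
  have hq := Tendsto.comp hc ht
  obtain ⟨r, hr⟩ : ∃ r : ℝ, g y = r := ⟨(g y).toReal, (EReal.coe_toReal hy (hbot y)).symm⟩
  simp only [hr] at hq ⊢
  rw [← EReal.coe_add, EReal.toReal_coe]
  rw [← EReal.tendsto_coe]
  refine Tendsto.congr (fun k => ?_) (by simpa only [hr, ← EReal.coe_add] using hq)
  simp only [Function.comp, hG]
  norm_cast
  ring

lemma npg_gamma {X : Type*} [NormedAddCommGroup X] [InnerProductSpace ℝ X]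
    [FiniteDimensional ℝ X] (f : X → ℝ) (g : X → EReal) (hf : ContDiff ℝ 1 f)
    (hgc : Continuous (fun y => gradient f y)) (hbot : ∀ y, g y ≠ ⊥)
    (hg_affine : ∃ (b : X) (c : ℝ), ∀ y, ((⟪b, y⟫ + c : ℝ) : EReal) ≤ g y) (q0 : ℝ)
    (τ γmax δ : ℝ) (hτ : 1 < τ) (hδ : δ ∈ Set.Ioo (0:ℝ) 1)
    (xb : X) (ρ L : ℝ) (hρ : 0 < ρ) (hρ1 : ρ ≤ 1) (hL : 0 ≤ L)
    (hlip : ∀ u ∈ ball xb (2 * ρ), ∀ v ∈ ball xb (2 * ρ),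
      ‖gradient f u - gradient f v‖ ≤ L * ‖u - v‖) :
    ∃ Γ : ℝ, 0 ≤ Γ ∧ ∀ (u : X) (γ q Ql : ℝ), u ∈ ball xb ρ → g u = ((q - f u : ℝ) : EReal) →
      q ≤ q0 → q ≤ Ql →
      (γmax < γ → ∃ xh : X,
      (∀ y : X, ((f u + ⟪gradient f u, xh - u⟫
          + (γ / τ) / 2 * ‖xh - u‖ ^ 2 : ℝ) : EReal) + g xh
        ≤ ((f u + ⟪gradient f u, y - u⟫
          + (γ / τ) / 2 * ‖y - u‖ ^ 2 : ℝ) : EReal) + g y)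
      ∧ ((Ql - δ * γ / (2 * τ) * ‖xh - u‖ ^ 2 : ℝ) : EReal) < (f xh : EReal) + g xh) →
      γ ≤ Γ := by
  obtain ⟨A, hA0, hA⟩ := npg_stepbound f g hf hgc hg_affine (‖xb‖ + 1) q0
  obtain ⟨hδ0, hδ1⟩ := hδ
  have h1δ : 0 < 1 - δ := by linarith
  have hτ0 : 0 < τ := by linarith
  refine ⟨|γmax| + τ * (4 * A / ρ ^ 2) + τ * (2 * L / (1 - δ)), by positivity, ?_⟩
  intro u γ q Ql hu hgu hq hqQ htr
  by_contra hcon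
  push Not at hcon
  have p1 : 0 ≤ τ * (4 * A / ρ ^ 2) := by positivity
  have p2 : 0 ≤ τ * (2 * L / (1 - δ)) := by positivity
  have p3 := le_abs_self γmax
  have p4 := abs_nonneg γmax
  obtain ⟨z, hz, hz2⟩ := htr (by linarith)
  have b1 : 4 * A / ρ ^ 2 < γ / τ := by rw [lt_div_iff₀ hτ0]; linarith
  have b2 : 2 * L / (1 - δ) < γ / τ := by rw [lt_div_iff₀ hτ0]; linarith
  have hun : ‖u‖ ≤ ‖xb‖ + 1 := by
    have := norm_le_norm_add_norm_sub' u xb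
    rw [mem_ball, dist_eq_norm] at hu
    linarith
  have hs := hA u z (γ / τ) q hun hgu hq (hz u)
  set β := γ / τ with hβ
  set t := ‖z - u‖ with ht
  have ht0 : 0 ≤ t := norm_nonneg _
  rw [div_lt_iff₀ (by positivity)] at b1 b2
  have hβ0 : 0 < β := by
    by_contra hn
    push Not at hn
    nlinarith [sq_nonneg ρ]
  have htρ : t < ρ := by
    by_contra hn
    push Not at hn
    by_cases ht1 : t ≤ 1
    · have : β * ρ ^ 2 ≤ β * t ^ 2 := by gcongr
      nlinarith
    · push Not at ht1
      have e1 : β * ρ ^ 2 ≤ β := by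
        have : ρ ^ 2 ≤ 1 := by nlinarith
        nlinarith
      have e2 : 4 * A * t < β * t := by nlinarith
      have e3 : β * t ≤ β * t ^ 2 := by
        have : t ≤ t ^ 2 := by nlinarith
        nlinarith
      nlinarith
  have hzb : z ∈ ball xb (2 * ρ) := by
    rw [mem_ball] at hu ⊢
    have := dist_triangle z u xb
    rw [dist_eq_norm z u] at this
    linarith
  have hub : u ∈ ball xb (2 * ρ) := ball_subset_ball (by linarith) hu
  have hd := npg_descent f hf xb (2 * ρ) L hL hlip u z hub hzb
  have hzu := hz u
  have hzt : g z ≠ ⊤ := by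
    intro h
    rw [h, hgu] at hzu
    rw [EReal.coe_add_top, ← EReal.coe_add] at hzu
    exact absurd (top_le_iff.1 hzu) (EReal.coe_ne_top _)
  obtain ⟨r, hr⟩ : ∃ r : ℝ, g z = r := ⟨(g z).toReal, (EReal.coe_toReal hzt (hbot z)).symm⟩
  rw [hr, hgu] at hzu
  rw [hr] at hz2
  norm_cast at hzu hz2
  simp only [sub_self, inner_zero_right, norm_zero] at hzu
  have e : δ * γ / (2 * τ) = δ * β / 2 := by rw [hβ]; field_simp
  rw [e] at hz2
  have hfin : L * t ^ 2 ≤ β * (1 - δ) / 2 * t ^ 2 := by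
    have : L ≤ β * (1 - δ) / 2 := by linarith
    gcongr
  nlinarith

lemma npg_lyap2 {X : Type*} [NormedAddCommGroup X] (x : ℕ → X) (xb : X) (T ψ : ℕ → ℝ)
    (C1 C2 r : ℝ) (N M : ℕ) (hC1 : 0 < C1) (hC2 : 0 ≤ C2) (hr : 0 < r)
    (hT : ∀ k, 0 ≤ T k) (hTt : Tendsto T atTop (𝓝 0))
    (hψ : ∀ k ≥ N, 0 ≤ ψ k) (hψt : Tendsto ψ atTop (𝓝 0))
    (hs : ∀ k ≥ N, ‖x k - xb‖ ≤ r → ‖x (k + 1) - x k‖ ≤ C1 * T k ∧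
      T (k + M) ≤ T k / 2 + C2 / 2 * (ψ (k + M) - ψ (k + M + M)))
    (φ : ℕ → ℕ) (hφ : StrictMono φ) (hconv : Tendsto (fun j => x (φ j)) atTop (𝓝 xb)) :
    Tendsto x atTop (𝓝 xb) := by
  have tel : ∀ (S : ℕ → ℝ) (k : ℕ), ∑ i ∈ Finset.range M, S (k + i) -
      ∑ i ∈ Finset.range M, S (k + 1 + i) = S k - S (k + M) := by
    intro S k
    have e1 := Finset.sum_range_succ (fun i => S (k + i)) M
    have e2 := Finset.sum_range_succ' (fun i => S (k + i)) M
    have e3 : ∑ i ∈ Finset.range M, S (k + 1 + i) = ∑ i ∈ Finset.range M, S (k + (i + 1)) :=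
      Finset.sum_congr rfl fun i _ => by congr 1; ring
    simp only [add_zero] at e2
    rw [e3]
    linarith
  refine npg_lyap x xb (fun k => ∑ i ∈ Finset.range M, T (k + i) +
    C2 / 2 * ∑ i ∈ Finset.range M, ψ (k + M + i)) (2 * C1) r N (by positivity) hr ?_ ?_ ?_ φ hφ hconv
  · intro k hk
    have a1 : 0 ≤ ∑ i ∈ Finset.range M, T (k + i) := Finset.sum_nonneg fun i _ => hT _
    have a2 : 0 ≤ ∑ i ∈ Finset.range M, ψ (k + M + i) :=
      Finset.sum_nonneg fun i _ => hψ _ (by omega)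
    positivity
  · have b1 : Tendsto (fun k => ∑ i ∈ Finset.range M, T (k + i)) atTop
        (𝓝 (∑ i ∈ Finset.range M, (0 : ℝ))) :=
      tendsto_finsetSum _ fun i _ => hTt.comp (tendsto_add_atTop_nat i)
    have b2 : Tendsto (fun k => ∑ i ∈ Finset.range M, ψ (k + M + i)) atTop
        (𝓝 (∑ i ∈ Finset.range M, (0 : ℝ))) :=
      tendsto_finsetSum _ fun i _ => by
        have := hψt.comp (tendsto_add_atTop_nat (M + i))
        refine this.congr fun k => ?_
        simp [add_assoc]
    simpa using b1.add (b2.const_mul (C2 / 2))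
  · intro k hk hkr
    obtain ⟨h1, h2⟩ := hs k hk hkr
    have t1 := tel T k
    have t2 := tel ψ (k + M)
    have e : ∀ i, k + 1 + M + i = k + M + 1 + i := fun i => by ring
    simp only [e]
    refine h1.trans ?_
    rw [mul_comm 2 C1, mul_assoc]
    refine mul_le_mul_of_nonneg_left ?_ hC1.le
    have : C2 / 2 * (∑ i ∈ Finset.range M, ψ (k + M + i)) -
      C2 / 2 * (∑ i ∈ Finset.range M, ψ (k + M + 1 + i)) =
        C2 / 2 * (ψ (k + M) - ψ (k + M + M)) := by rw [← mul_sub, t2]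
    linarith

set_option maxHeartbeats 2000000 in
theorem stmt18
    {X : Type*} [NormedAddCommGroup X] [InnerProductSpace ℝ X] [FiniteDimensional ℝ X]
    (f : X → ℝ) (g : X → EReal)
    (hf : ContDiff ℝ 1 f)
    (hg_lsc : LowerSemicontinuous g)
    (hg_proper : ∃ y, g y ≠ ⊤)
    (hq_bddbelow : ∃ c : ℝ, ∀ y, g y ≠ ⊤ → (c : EReal) ≤ (f y : EReal) + g y)
    (hg_affine : ∃ (b : X) (c : ℝ), ∀ y, ((⟪b, y⟫ + c : ℝ) : EReal) ≤ g y)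
    (hgrad_lip : LocallyLipschitz (fun y => gradient f y))
    (hq_cont : ContinuousOn (fun y => (f y : EReal) + g y) {y | g y ≠ ⊤})
    (τ γmin γmax δ : ℝ) (m : ℕ)
    (hτ : 1 < τ) (hγmin : 0 < γmin) (hγminmax : γmin ≤ γmax)
    (hδ : δ ∈ Set.Ioo (0:ℝ) 1)
    (x : ℕ → X) (γ : ℕ → ℝ) (qx : ℕ → ℝ) (l : ℕ → ℕ)
    (hdom : ∀ k, g (x k) ≠ ⊤)
    (hqx : ∀ k, (qx k : EReal) = (f (x k) : EReal) + g (x k))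
    (hγlb : ∀ k, γmin ≤ γ k)
    (hl : ∀ k, k - min k m ≤ l k ∧ l k ≤ k ∧ ∀ j ≤ min k m, qx (k - j) ≤ qx (l k))
    (hstep : ∀ k, ∀ y : X,
      ((f (x k) + ⟪gradient f (x k), x (k + 1) - x k⟫
          + γ k / 2 * ‖x (k + 1) - x k‖ ^ 2 : ℝ) : EReal) + g (x (k + 1))
        ≤ ((f (x k) + ⟪gradient f (x k), y - x k⟫
          + γ k / 2 * ‖y - x k‖ ^ 2 : ℝ) : EReal) + g y)
    (haccept : ∀ k, qx (k + 1) ≤ qx (l k) - δ * γ k / 2 * ‖x (k + 1) - x k‖ ^ 2)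
    (htrial : ∀ k, γmax < γ k → ∃ xh : X,
      (∀ y : X, ((f (x k) + ⟪gradient f (x k), xh - x k⟫
          + (γ k / τ) / 2 * ‖xh - x k‖ ^ 2 : ℝ) : EReal) + g xh
        ≤ ((f (x k) + ⟪gradient f (x k), y - x k⟫
          + (γ k / τ) / 2 * ‖y - x k‖ ^ 2 : ℝ) : EReal) + g y)
      ∧ ((qx (l k) - δ * γ k / (2 * τ) * ‖xh - x k‖ ^ 2 : ℝ) : EReal) < (f xh : EReal) + g xh)
    (xbar : X) (φ : ℕ → ℕ) (hφ : StrictMono φ)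
    (hconv : Filter.Tendsto (fun j => x (φ j)) Filter.atTop (nhds xbar))
    (hKL : HasKLProperty (fun y => (f y : EReal) + g y) xbar) :
    Filter.Tendsto x Filter.atTop (nhds xbar) := by
  have hgc : Continuous (fun y => gradient f y) := hgrad_lip.continuous
  have hbot : ∀ y, g y ≠ ⊥ := by
    obtain ⟨b, c, hb⟩ := hg_affine
    intro y hy
    have := hb y
    rw [hy] at this
    exact absurd (le_bot_iff.1 this) (EReal.coe_ne_bot _)
  have hG : ∀ k, g (x k) = ((qx k - f (x k) : ℝ) : EReal) := by
    intro k
    obtain ⟨r, hr⟩ : ∃ r : ℝ, g (x k) = r :=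
      ⟨(g (x k)).toReal, (EReal.coe_toReal (hdom k) (hbot _)).symm⟩
    have := hqx k
    rw [hr] at this ⊢
    norm_cast at this ⊢
    linarith
  obtain ⟨hδ0, hδ1⟩ := id hδ
  have ha : 0 < δ * γmin / 2 := by positivity
  set a := δ * γmin / 2 with ha_def
  set Q : ℕ → ℝ := fun k => qx (l k) with hQdef
  have h1 : ∀ i, a * ‖x (i + 1) - x i‖ ^ 2 ≤ Q i - qx (i + 1) := by
    intro i
    have e1 := haccept i
    have e2 : a ≤ δ * γ i / 2 := by
      rw [ha_def]
      have := hγlb i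
      gcongr
    have e3 := mul_le_mul_of_nonneg_right e2 (sq_nonneg ‖x (i + 1) - x i‖)
    simp only [hQdef]
    linarith
  have hqQ : ∀ k, qx k ≤ Q k := fun k => by simpa using (hl k).2.2 0 (Nat.zero_le _)
  have hQ : Antitone Q := by
    refine antitone_nat_of_succ_le fun k => ?_
    obtain ⟨p1, p2, -⟩ := hl (k + 1)
    rcases Nat.lt_or_ge k (l (k + 1)) with h | h
    · have : l (k + 1) = k + 1 := by omega
      have e := h1 k
      have : 0 ≤ a * ‖x (k + 1) - x k‖ ^ 2 := by positivity
      simp only [hQdef] at e ⊢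
      rw [‹l (k + 1) = k + 1›]
      linarith
    · have e := (hl k).2.2 (k - l (k + 1)) (by omega)
      rwa [show k - (k - l (k + 1)) = l (k + 1) by omega] at e
  have hq0 : ∀ k, qx k ≤ Q 0 := fun k => (hqQ k).trans (hQ (Nat.zero_le k))
  have hQb : BddBelow (range Q) := by
    obtain ⟨c, hc⟩ := hq_bddbelow
    refine ⟨c, ?_⟩
    rintro _ ⟨k, rfl⟩
    have := hc (x (l k)) (hdom _)
    rw [← hqx] at this
    exact_mod_cast this
  have hQt := tendsto_atTop_ciInf hQ hQb
  set qs := ⨅ i, Q i with hqs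
  have hQge : ∀ k, qs ≤ Q k := fun k => ciInf_le hQb k
  have hbd : ∀ R, ∃ R', ∀ k, ‖x k‖ ≤ R → ‖x (k + 1)‖ ≤ R' := by
    intro R
    obtain ⟨A, hA0, hA⟩ := npg_stepbound f g hf hgc hg_affine R (Q 0)
    refine ⟨R + (1 + 4 * A / γmin), fun k hk => ?_⟩
    have e := hA (x k) (x (k + 1)) (γ k) (qx k) hk (hG k) (hq0 k) (hstep k (x k))
    have e2 : ‖x (k + 1) - x k‖ ≤ 1 + 4 * A / γmin := by
      by_contra hn
      push Not at hn
      set t := ‖x (k + 1) - x k‖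
      have p : 0 ≤ 4 * A / γmin := by positivity
      have ht1 : 1 < t := by linarith
      have ht2 : 4 * A / γmin < t := by linarith
      rw [div_lt_iff₀ hγmin] at ht2
      have q1 : γmin * t ^ 2 ≤ γ k * t ^ 2 := by
        have := hγlb k
        gcongr
      have q2 : 4 * A * t < t * γmin * t := by
        have : 0 < t := by linarith
        gcongr
      nlinarith
    have := norm_le_norm_add_norm_sub' (x (k + 1)) (x k)
    linarith
  have hcont0 := npg_cont f g hf.continuous hg_lsc hbot hq_cont x qx (Q 0) hG hq0
  have hcont : ∀ (U : Ultrafilter ℕ) (s : ℕ → ℕ) (y : X), Tendsto (fun k => x (s k)) U (𝓝 y) →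
      Tendsto (fun k => qx (s k)) U (𝓝 ((f y : EReal) + g y).toReal) :=
    fun U s y h => (hcont0 U s y h).2
  have hl' : ∀ k, ∃ i ∈ Iic m, qx (k + 1 + i) = Q (k + m + 1) := by
    intro k
    obtain ⟨p1, p2, -⟩ := hl (k + m + 1)
    refine ⟨l (k + m + 1) - (k + 1), by simp only [mem_Iic]; omega, ?_⟩
    simp only [hQdef]
    congr 1
    omega
  have hqbar : (f xbar : EReal) + g xbar = (qs : EReal) := by
    set U := Ultrafilter.of (atTop : Filter ℕ) with hUd
    have hU : (U : Filter ℕ) ≤ atTop := Ultrafilter.of_le _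
    have hx := hconv.mono_left hU
    obtain ⟨c1, c2⟩ := hcont0 U φ xbar hx
    have hV : Tendsto qx (U.map φ) (𝓝 qs) := by
      refine npg_ultraA x qx Q m a qs ha hQt h1 hbd (fun y => ((f y : EReal) + g y).toReal)
        hcont hl' (U.map φ) (hφ.tendsto_atTop.mono_left hU) (‖xbar‖ + 1) ?_
      change ∀ᶠ k in (U : Filter ℕ), ‖x (φ k)‖ ≤ ‖xbar‖ + 1
      exact (hx.norm.eventually (gt_mem_nhds (lt_add_one _))).mono fun k hk => hk.le
    have hV' : Tendsto (fun k => qx (φ k)) U (𝓝 qs) := hV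
    rw [tendsto_nhds_unique hV' c2, EReal.coe_toReal]
    · exact EReal.add_ne_top (EReal.coe_ne_top _) c1
    · exact fun h => (EReal.add_eq_bot_iff.1 h).elim (EReal.coe_ne_bot _) (hbot _)
  obtain ⟨η, χ, χ', hη, hχ0, hχn, hχc, hχcc, -, hχd, V, hV, hKLV⟩ := hKL
  obtain ⟨K, t, ht, hKt⟩ := hgrad_lip xbar
  obtain ⟨ρ', hρ'0, hρ'⟩ := Metric.mem_nhds_iff.1 (inter_mem ht hV)
  obtain ⟨ρ, hρ0, hρ1, hρ2⟩ : ∃ ρ > 0, ρ ≤ 1 ∧ 2 * ρ ≤ ρ' :=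
    ⟨min 1 (ρ' / 2), lt_min one_pos (by linarith), min_le_left _ _, by
      have := min_le_right 1 (ρ' / 2)
      linarith⟩
  have hsub : ball xbar (2 * ρ) ⊆ t ∩ V := (ball_subset_ball hρ2).trans hρ'
  set L : ℝ := (K : ℝ) with hLdef
  have hL : 0 ≤ L := K.2
  have hlip : ∀ u ∈ ball xbar (2 * ρ), ∀ v ∈ ball xbar (2 * ρ),
      ‖gradient f u - gradient f v‖ ≤ L * ‖u - v‖ := fun u hu v hv =>
    hKt.norm_sub_le (hsub hu).1 (hsub hv).1
  obtain ⟨Γ, hΓ0, hΓ⟩ := npg_gamma f g hf hgc hbot hg_affine (Q 0) τ γmax δ hτ hδ xbar ρ L hρ0 hρ1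
    hL hlip
  have hsmall := npg_small x qx Q m a qs ha hQt h1 hbd (fun y => ((f y : EReal) + g y).toReal)
    hcont hl' (‖xbar‖ + 1) (ρ / (4 * (m + 1))) (by positivity)
  have hev : ∀ᶠ k in atTop, Q k < qs + η := hQt.eventually (gt_mem_nhds (by linarith))
  obtain ⟨N, hN⟩ := eventually_atTop.1 (hsmall.and hev)
  set M := m + 1 with hM
  set B := 1 + L / a with hB
  have hB1 : 1 ≤ B := by
    have : 0 ≤ L / a := by positivity
    linarith
  set C1 := √(B ^ M / a) with hC1d
  have hC1 : 0 < C1 := Real.sqrt_pos.2 (by positivity)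
  set T : ℕ → ℝ := fun k => √(Q k - Q (k + M)) with hTd
  have hTsq : ∀ k, T k ^ 2 = Q k - Q (k + M) := fun k =>
    Real.sq_sqrt (sub_nonneg.2 (hQ (Nat.le_add_right _ _)))
  have hT0 : ∀ k, 0 ≤ T k := fun k => Real.sqrt_nonneg _
  have hDT : ∀ k D, a * D ^ 2 ≤ B ^ M * (Q k - Q (k + M)) → D ≤ C1 * T k := by
    intro k D h
    have : D ^ 2 ≤ (C1 * T k) ^ 2 := by
      rw [mul_pow, hTsq, hC1d, Real.sq_sqrt (by positivity), div_mul_eq_mul_div,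
        le_div_iff₀ ha]
      linarith
    exact le_of_abs_le (abs_le_of_sq_le_sq this (mul_nonneg hC1.le (hT0 k)))
  have hTt : Tendsto T atTop (𝓝 0) := by
    have := (hQt.sub (hQt.comp (tendsto_add_atTop_nat M))).sqrt
    simpa using this
  have hmem : ∀ k ≥ N, Q k - qs ∈ Icc 0 η := fun k hk =>
    ⟨sub_nonneg.2 (hQge k), by linarith [(hN k hk).2]⟩
  have hψt : Tendsto (fun k => χ (Q k - qs)) atTop (𝓝 0) := by
    have e1 : Tendsto (fun k => Q k - qs) atTop (𝓝[Icc 0 η] 0) := by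
      refine tendsto_nhdsWithin_iff.2 ⟨?_, eventually_atTop.2 ⟨N, hmem⟩⟩
      simpa using hQt.sub_const qs
    have := (hχc 0 ⟨le_rfl, hη.le⟩).tendsto.comp e1
    rwa [hχ0] at this
  refine npg_lyap2 x xbar T (fun k => χ (Q k - qs)) C1 ((L + Γ + 1) * C1) (ρ / 2) N M hC1
    (by positivity) (by positivity) hT0 hTt (fun k hk => hχn _ (hmem k hk)) hψt ?_ φ hφ hconv
  intro k hk hkr
  have hnear : ∀ i ≤ M, ‖x (k + i) - xbar‖ ≤ ρ / 2 + i * (ρ / (4 * M)) := by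
    intro i
    induction i with
    | zero => simpa using hkr
    | succ i ih =>
      intro hi
      have e := ih (by omega)
      have e0 : (i : ℝ) * (ρ / (4 * M)) ≤ ρ / 4 := by
        have : (i : ℝ) ≤ M := by exact_mod_cast (by omega : i ≤ M)
        rw [mul_div_assoc', div_le_div_iff₀ (by positivity) (by norm_num)]
        nlinarith
      have e1 : ‖x (k + i)‖ ≤ ‖xbar‖ + 1 := by
        have := norm_le_norm_add_norm_sub' (x (k + i)) xbar
        linarith
      have e2 := (hN (k + i) (by omega)).1 e1
      have e3 := norm_sub_le_norm_sub_add_norm_sub (x (k + i + 1)) (x (k + i)) xbar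
      rw [← add_assoc]
      rw [hM] at e ⊢
      push_cast at e ⊢
      linarith
  have hball : ∀ i ≤ M, x (k + i) ∈ ball xbar ρ := by
    intro i hi
    have e := hnear i hi
    have e0 : (i : ℝ) * (ρ / (4 * M)) ≤ ρ / 4 := by
      have : (i : ℝ) ≤ M := by exact_mod_cast hi
      rw [mul_div_assoc', div_le_div_iff₀ (by positivity) (by norm_num)]
      nlinarith
    rw [mem_ball, dist_eq_norm]
    linarith
  have hball2 : ∀ i ≤ M, x (k + i) ∈ ball xbar (2 * ρ) := fun i hi =>
    ball_subset_ball (by linarith) (hball i hi)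
  obtain ⟨i, him, hij⟩ := hl' k
  simp only [mem_Iic] at him
  rw [show k + m + 1 = k + M by omega] at hij
  have hback := npg_back qx Q (fun i => ‖x (i + 1) - x i‖) a L k (k + 1 + i)
    (Q k - Q (k + M)) ha hL hQ (by omega) h1 (by
      intro p hp1 hp2
      obtain ⟨n, rfl⟩ := Nat.exists_eq_add_of_le hp1
      have hd := npg_descent f hf xbar (2 * ρ) L hL hlip (x (k + n)) (x (k + n + 1))
        (hball2 n (by omega)) (hball2 (n + 1) (by omega))
      have hs := hstep (k + n) (x (k + n))
      rw [hG, hG] at hs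
      norm_cast at hs
      simp only [sub_self, inner_zero_right, norm_zero] at hs
      have : 0 ≤ γ (k + n) / 2 * ‖x (k + n + 1) - x (k + n)‖ ^ 2 := by
        have := hγlb (k + n)
        have : 0 ≤ γ (k + n) := by linarith
        positivity
      linarith) (by rw [hij])
  have hΔ0 : 0 ≤ Q k - Q (k + M) := sub_nonneg.2 (hQ (Nat.le_add_right _ _))
  constructor
  · apply hDT
    refine (h1 k).trans ((hback i (k + 1) rfl le_rfl).trans ?_)
    gcongr
    omega
  · set s := Q (k + M) - qs with hs
    set s2 := Q (k + M + M) - qs with hs2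
    have hss : s - s2 = T (k + M) ^ 2 := by rw [hTsq]; ring
    have hsm : s ∈ Icc 0 η := hmem _ (by omega)
    have hs2m : s2 ∈ Icc 0 η := hmem _ (by omega)
    have hs21 : s2 ≤ s := by nlinarith [sq_nonneg (T (k + M))]
    rcases hs21.eq_or_lt with heq | hlt
    · have : T (k + M) = 0 := by
        have : T (k + M) ^ 2 = 0 := by rw [← hss, heq, sub_self]
        exact pow_eq_zero_iff (two_ne_zero) |>.1 this
      rw [this, heq, sub_self, mul_zero, add_zero]
      have := hT0 k
      linarith
    · have hs0 : 0 < s := lt_of_le_of_lt hs2m.1 hlt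
      have hsη : s < η := by linarith [(hN (k + M) (by omega)).2]
      obtain ⟨hder, hpos⟩ := hχd s ⟨hs0, hsη⟩
      have hconc : χ' s * (s - s2) ≤ χ s - χ s2 := by
        have := hχcc.le_slope_of_hasDerivAt hs2m hsm hlt hder
        rw [slope_def_field, le_div_iff₀ (sub_pos.2 hlt)] at this
        exact this
      have hqv : (f (x (k + 1 + i)) : EReal) + g (x (k + 1 + i)) = ((Q (k + M) : ℝ) : EReal) := by
        rw [← hqx, hij]
      have hidx : k + 1 + i = k + i + 1 := by ring
      have hkl := hKLV (x (k + 1 + i)) (by rw [hidx]; exact (hsub (hball2 (i + 1) (by omega))).2)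
      simp only [hqbar, hqv] at hkl
      have hkl2 := hkl (by exact_mod_cast sub_pos.1 hs0)
        (by rw [← EReal.coe_add]; exact_mod_cast (hN (k + M) (by omega)).2)
      rw [← EReal.coe_sub, EReal.toReal_coe, ← hs] at hkl2
      have hfr := npg_frechet f g hf (x (k + i)) (x (k + i + 1)) (γ (k + i)) _ (hG _)
        (hstep (k + i))
      rw [hidx] at hkl2
      have hw := npg_KL _ _ _ _ hpos hfr hkl2
      have hD : ‖x (k + i + 1) - x (k + i)‖ ≤ C1 * T k := by
        apply hDT
        refine (h1 (k + i)).trans ?_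
        rw [← hidx, hij]
        have e1 := hQ (show k ≤ k + i by omega)
        have e2 : 1 ≤ B ^ M := one_le_pow₀ hB1
        nlinarith
      have hγu : γ (k + i) ≤ Γ := hΓ (x (k + i)) (γ (k + i)) (qx (k + i)) (Q (k + i))
        (hball i (by omega)) (hG _) (hq0 _) (hqQ _) (htrial (k + i))
      have hγ0 : 0 ≤ γ (k + i) := by linarith [hγlb (k + i)]
      have hwn : ‖gradient f (x (k + i + 1)) - gradient f (x (k + i)) -
          γ (k + i) • (x (k + i + 1) - x (k + i))‖ ≤ (L + Γ + 1) * C1 * T k := by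
        refine (norm_sub_le _ _).trans ?_
        rw [norm_smul, Real.norm_of_nonneg hγ0]
        have e1 := hlip _ (hball2 (i + 1) (by omega)) _ (hball2 i (by omega))
        rw [← add_assoc] at e1
        have e2 := mul_le_mul_of_nonneg_right hγu (norm_nonneg (x (k + i + 1) - x (k + i)))
        have e3 := mul_le_mul_of_nonneg_left hD (show 0 ≤ L + Γ + 1 by positivity)
        have e4 := norm_nonneg (x (k + i + 1) - x (k + i))
        calc _ ≤ L * ‖x (k + i + 1) - x (k + i)‖ + Γ * ‖x (k + i + 1) - x (k + i)‖ :=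
              add_le_add e1 e2
          _ ≤ (L + Γ + 1) * ‖x (k + i + 1) - x (k + i)‖ := by linarith
          _ ≤ (L + Γ + 1) * (C1 * T k) := e3
          _ = (L + Γ + 1) * C1 * T k := by ring
      set C2 := (L + Γ + 1) * C1 with hC2
      set Δ := χ s - χ s2 with hΔ
      have hΔn : 0 ≤ Δ := le_trans (mul_nonneg hpos.le (by linarith)) hconc
      have hC2n : 0 ≤ C2 := by positivity
      have hone : 1 ≤ χ' s * (C2 * T k) := hw.trans (mul_le_mul_of_nonneg_left hwn hpos.le)
      have hT2 : T (k + M) ^ 2 ≤ C2 * T k * Δ := by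
        have a1 : T (k + M) ^ 2 * 1 ≤ T (k + M) ^ 2 * (χ' s * (C2 * T k)) :=
          mul_le_mul_of_nonneg_left hone (sq_nonneg _)
        have a2 := mul_le_mul_of_nonneg_left hconc (mul_nonneg hC2n (hT0 k))
        rw [hss] at a2
        nlinarith
      have hfin : T (k + M) ^ 2 ≤ (T k / 2 + C2 / 2 * Δ) ^ 2 := by
        nlinarith [sq_nonneg (T k - C2 * Δ)]
      have := hT0 k
      exact le_of_abs_le (abs_le_of_sq_le_sq hfin (by positivity))
end
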